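/- Let H be a complex Hilbert space and M a von Neumann algebra acting on H. Every continuous local triple derivation δ : M → M is a triple derivation: δ⦃x,y,z⦄ = ⦃δx, y, z⦄ + ⦃x, δy, z⦄ + ⦃x, y, δz⦄ for all x, y, z ∈ M. -/

import Mathlib

/-- Scalars of a von Neumann algebra: a `VonNeumannAlgebra H` is closed under `ℂ`-scalar
multiplication (it is a star subalgebra), so its subtype carries a `ℂ`-module structure. -/
instance VonNeumannAlgebra.instSMulMemClass {H : Type*} [NormedAddCommGroup H]
    [InnerProductSpace ℂ H] [CompleteSpace H] :
    SMulMemClass (VonNeumannAlgebra H) ℂ (H →L[ℂ] H) where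
  smul_mem {s} c a ha := s.toStarSubalgebra.smul_mem ha c

/-- The triple product `⦃x,y,z⦄ := (x·y*·z + z·y*·x)/2`. -/
noncomputable def tp {A : Type*} [Ring A] [SMul ℂ A] [Star A] (x y z : A) : A :=
  (2 : ℂ)⁻¹ • (x * star y * z + z * star y * x)

/-- A triple derivation: a `ℂ`-linear map `δ` with
`δ⦃x,y,z⦄ = ⦃δx,y,z⦄ + ⦃x,δy,z⦄ + ⦃x,y,δz⦄` for all `x,y,z`. -/
def IsTripleDerivation {A : Type*} [Ring A] [Module ℂ A] [Star A] (δ : A →ₗ[ℂ] A) : Prop :=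
  ∀ x y z : A, δ (tp x y z) = tp (δ x) y z + tp x (δ y) z + tp x y (δ z)

section PureAlgebra

variable {A : Type*} [Ring A] [Algebra ℂ A]

/-- Left and right multiplication averaged: `x ↦ (a * x + x * a) / 2`. -/
noncomputable def jordanMul (a : A) : A →ₗ[ℂ] A :=
  (2 : ℂ)⁻¹ • (LinearMap.mulLeft ℂ a + LinearMap.mulRight ℂ a)

theorem jordanMul_apply (a x : A) : jordanMul a x = (2 : ℂ)⁻¹ • (a * x + x * a) := rfl

variable [StarRing A]

/-- A triple derivation `T` satisfies `T u = -(u * (T u)* * u)` at every unitary `u`. -/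
theorem IsTripleDerivation.apply_unitary {T : A →ₗ[ℂ] A}
    (hT : IsTripleDerivation T) {u : A} (hu : u ∈ unitary A) :
    T u = -(u * star (T u) * u) := by
  have hl : star u * u = 1 := Unitary.star_mul_self_of_mem hu
  have hr : u * star u = 1 := Unitary.mul_star_self_of_mem hu
  have h := hT u u u
  simp only [tp, mul_assoc, hl, mul_one] at h
  simp only [← mul_assoc, hr, one_mul] at h
  simp only [← two_smul ℂ, smul_smul] at h
  norm_num at h
  exact eq_neg_of_add_eq_zero_left h

theorem IsTripleDerivation.add {S T : A →ₗ[ℂ] A} (hS : IsTripleDerivation S)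
    (hT : IsTripleDerivation T) : IsTripleDerivation (S + T) := by
  intro x y z
  simp only [LinearMap.add_apply, hS x y z, hT x y z]
  simp only [tp, star_add, mul_add, add_mul, smul_add]
  abel

variable [StarModule ℂ A]

theorem isTripleDerivation_jordanMul {a : A} (ha : star a = -a) :
    IsTripleDerivation (jordanMul a) := by
  intro x y z
  simp only [jordanMul_apply, tp, star_smul, star_add, star_mul, ha, star_inv₀, star_ofNat,
    mul_add, add_mul, smul_add, mul_smul_comm, smul_mul_assoc, smul_smul, mul_neg, neg_mul,
    mul_assoc, smul_neg]
  module

/-- A linear map which maps skew-adjoint elements to skew-adjoint elements and obeys the Leibniz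
rule on squares of skew-adjoint elements is a triple derivation. -/
theorem isTripleDerivation_of_skewAdjoint {D : A →ₗ[ℂ] A}
    (hstar : ∀ k : A, star k = -k → star (D k) = -D k)
    (hsq : ∀ k : A, star k = -k → D (k * k) = k * D k + D k * k) : IsTripleDerivation D := by
  have skew_sub (x : A) : star (x - star x) = -(x - star x) := by simp
  have skew_add (x : A) : star (Complex.I • (x + star x)) = -(Complex.I • (x + star x)) := by
    simp [add_comm]
  have decomp (x : A) : x = (2 : ℂ)⁻¹ • (x - star x)
      + (-(Complex.I / 2)) • (Complex.I • (x + star x)) := by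
    rw [smul_smul, show -(Complex.I / 2) * Complex.I = (2 : ℂ)⁻¹ by
      linear_combination (-1 / 2 : ℂ) * Complex.I_mul_I]
    module
  have hD_star (x : A) : D (star x) = star (D x) := by
    have h₁ := hstar _ (skew_sub x)
    have h₂ := hstar _ (skew_add x)
    simp only [map_sub, map_add, map_smul, star_sub, star_add, star_smul, Complex.star_def,
      Complex.conj_I, neg_smul, neg_inj] at h₁ h₂
    have h₃ := smul_right_injective A Complex.I_ne_zero h₂
    linear_combination (norm := module) (-(2 : ℂ)⁻¹) • (h₁ + h₃)
  have polar (k l : A) (hk : star k = -k) (hl : star l = -l) :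
      D (k * l + l * k) = k * D l + D l * k + (l * D k + D k * l) := by
    have h := hsq (k + l) (by rw [star_add, hk, hl, neg_add])
    simp only [add_mul, mul_add, map_add, hsq k hk, hsq l hl] at h ⊢
    linear_combination (norm := abel) h
  have jordan (x y : A) : D (x * y + y * x) = x * D y + D y * x + (y * D x + D x * y) := by
    have h₁ := polar _ _ (skew_sub x) (skew_sub y)
    have h₂ := polar _ _ (skew_sub x) (skew_add y)
    have h₃ := polar _ _ (skew_add x) (skew_sub y)
    have h₄ := polar _ _ (skew_add x) (skew_add y)
    rw [decomp x, decomp y]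
    generalize x - star x = p at *
    generalize Complex.I • (x + star x) = q at *
    generalize y - star y = r at *
    generalize Complex.I • (y + star y) = s at *
    generalize -(Complex.I / 2) = c
    simp only [map_add, map_smul, add_mul, mul_add, smul_mul_assoc, mul_smul_comm, smul_smul,
      smul_add] at *
    linear_combination (norm := module) ((2 : ℂ)⁻¹ * (2 : ℂ)⁻¹) • h₁
      + ((2 : ℂ)⁻¹ * c) • h₂ + ((2 : ℂ)⁻¹ * c) • h₃ + (c * c) • h₄
  have tp_eq (x y z : A) : tp x y z = (4 : ℂ)⁻¹ • (((x * star y + star y * x) * z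
      + z * (x * star y + star y * x)) + ((z * star y + star y * z) * x
      + x * (z * star y + star y * z)) - ((x * z + z * x) * star y
      + star y * (x * z + z * x))) := by
    simp only [tp, add_mul, mul_add, mul_assoc]
    module
  intro x y z
  rw [tp_eq x y z]
  simp only [map_smul, map_sub, map_add D (_ * _ + _ * _) (_ * _ + _ * _), jordan, hD_star, tp]
  simp only [add_mul, mul_add, mul_assoc]
  module

end PureAlgebra

section Normed

variable {A : Type*} [NormedRing A] [NormedAlgebra ℂ A] [StarRing A] [StarModule ℂ A]
  [ContinuousStar A] [CompleteSpace A]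

open NormedSpace in
/-- A continuous linear map which vanishes at `1` and satisfies the triple derivation identity at
unitaries is a triple derivation. -/
theorem isTripleDerivation_of_unitary {D : A →ₗ[ℂ] A} (hcont : Continuous D) (h1 : D 1 = 0)
    (hu : ∀ u ∈ unitary A, D u = -(u * star (D u) * u)) : IsTripleDerivation D := by
  have hasDerivAt_D {f : ℝ → A} {f' : A} {t : ℝ} (hf : HasDerivAt f f' t) :
      HasDerivAt (fun s ↦ D (f s)) (D f') t :=
    ((⟨D, hcont⟩ : A →L[ℂ] A).restrictScalars ℝ).hasFDerivAt.comp_hasDerivAt t hf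
  have key (k : A) (hk : star k = -k) :
      (D k + star (D k) = 0) ∧ D (k * k) + star (D (k * k))
        + 2 • (k * star (D k) + star (D k) * k) = 0 := by
    have hv (t : ℝ) : HasDerivAt (fun s : ℝ ↦ exp (s • k)) (k * exp (t • k)) t :=
      hasDerivAt_exp_smul_const' k t
    have hF (t : ℝ) : D (exp (t • k)) + exp (t • k) * star (D (exp (t • k))) * exp (t • k)
        = 0 := by
      have hmem : exp (t • k) ∈ unitary A := by
        let : NormedAlgebra ℚ A := .restrictScalars ℚ ℂ A
        refine exp_mem_unitary_of_mem_skewAdjoint ?_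
        rw [skewAdjoint.mem_iff, star_smul, hk, star_trivial, smul_neg]
      exact eq_neg_iff_add_eq_zero.mp (hu _ hmem)
    have hF' (t : ℝ) := (hasDerivAt_D (hv t)).add
      (((hv t).mul (hasDerivAt_D (hv t)).star).mul (hv t))
    have hG (t : ℝ) := ((hF' t).congr_of_eventuallyEq
      (.of_forall fun s ↦ (hF s).symm)).unique (hasDerivAt_const t 0)
    have hkv := (hv 0).const_mul k
    have hG' := (hasDerivAt_D hkv).add
      (((((hkv.mul (hasDerivAt_D (hv 0)).star).add
        ((hv 0).mul (hasDerivAt_D hkv).star))).mul (hv 0)).add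
        (((hv 0).mul (hasDerivAt_D (hv 0)).star).mul hkv))
    have hG'' := (hG'.congr_of_eventuallyEq
      (.of_forall fun s ↦ (hG s).symm)).unique (hasDerivAt_const (0 : ℝ) 0)
    have hG₀ := hG 0
    simp only [zero_smul, exp_zero, mul_one, one_mul, h1, star_zero, mul_zero, zero_mul,
      zero_add, add_zero, Pi.mul_apply, Pi.add_apply] at hG₀ hG''
    refine ⟨hG₀, ?_⟩
    rw [← hG'']
    abel
  have hstar (k : A) (hk : star k = -k) : star (D k) = -D k :=
    eq_neg_of_add_eq_zero_right (key k hk).1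
  refine isTripleDerivation_of_skewAdjoint hstar fun k hk ↦ ?_
  have hkk : star (D (k * k)) = D (k * k) := by
    have h := hstar (Complex.I • (k * k)) (by simp [hk])
    simp only [map_smul, star_smul, Complex.star_def, Complex.conj_I, neg_smul, neg_inj] at h
    exact smul_right_injective A Complex.I_ne_zero h
  have h := (key k hk).2
  rw [hkk, hstar k hk, mul_neg, neg_mul] at h
  linear_combination (norm := module) (2 : ℂ)⁻¹ • h

/-- Every continuous local triple derivation on a complete normed unital star algebra is a triple
derivation. -/
theorem isTripleDerivation_of_local {δ : A →ₗ[ℂ] A} (hcont : Continuous δ)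
    (hloc : ∀ x : A, ∃ T : A →ₗ[ℂ] A, IsTripleDerivation T ∧ T x = δ x) :
    IsTripleDerivation δ := by
  have hu (u : A) (hmem : u ∈ unitary A) : δ u = -(u * star (δ u) * u) := by
    obtain ⟨T, hT, h⟩ := hloc u
    rw [← h]
    exact hT.apply_unitary hmem
  have ha : star (δ 1) = -δ 1 := by simpa [eq_neg_iff_add_eq_zero, add_comm] using hu 1 (one_mem _)
  have hJ := isTripleDerivation_jordanMul ha
  have hD : IsTripleDerivation (δ - jordanMul (δ 1)) := by
    refine isTripleDerivation_of_unitary ?_ ?_ fun u hmem ↦ ?_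
    · have : Continuous fun x ↦ δ x - (2 : ℂ)⁻¹ • (δ 1 * x + x * δ 1) := by fun_prop
      exact this
    · rw [LinearMap.sub_apply, jordanMul_apply]
      simp only [mul_one, one_mul]
      module
    · have h₁ := hu u hmem
      have h₂ := hJ.apply_unitary hmem
      simp only [LinearMap.sub_apply, star_sub, mul_sub, sub_mul]
      linear_combination (norm := abel) h₁ - h₂
  simpa using hD.add hJ

end Normed

theorem VonNeumannAlgebra.isClosed {H : Type*} [NormedAddCommGroup H]
    [InnerProductSpace ℂ H] [CompleteSpace H] (M : VonNeumannAlgebra H) :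
    IsClosed (M : Set (H →L[ℂ] H)) := by
  rw [← M.centralizer_centralizer]
  exact Set.isClosed_centralizer _

/-- Every continuous local triple derivation on a von Neumann algebra is a triple
derivation. -/
theorem continuous_local_triple_derivation_is_triple_derivation
    {H : Type*} [NormedAddCommGroup H] [InnerProductSpace ℂ H] [CompleteSpace H]
    (M : VonNeumannAlgebra H)
    (δ : M →ₗ[ℂ] M) (hcont : Continuous δ)
    (hloc : ∀ x : M, ∃ T : M →ₗ[ℂ] M, IsTripleDerivation T ∧ T x = δ x) :
    IsTripleDerivation δ := by
  let : NormedAlgebra ℂ M :=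
    { (inferInstance : Module ℂ M), SubalgebraClass.toNormedAlgebra M.toStarSubalgebra with }
  have : StarModule ℂ M := StarSubalgebra.starModule M.toStarSubalgebra
  have : ContinuousStar M := ⟨(continuous_subtype_val.star).subtype_mk _⟩
  have : CompleteSpace M := M.isClosed.completeSpace_coe
  exact isTripleDerivation_of_local hcont hloc
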